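/- Let G be a group, H_L and H_R finite-dimensional complex inner product spaces, U_L : G → (unitaries on H_L) a projective representation with 2-cocycle ω_L, and U_R : G → (unitaries on H_R) arbitrary. Let ρ be a nonzero positive semidefinite operator on H_L ⊗ H_R of the bipartite-separable form ρ = Σ_i p_i |a_i ⊗ b_i⟩⟨a_i ⊗ b_i| with finitely many terms, p_i > 0, a_i ∈ H_L, b_i ∈ H_R, and suppose ρ is strongly symmetric: (U_L(g) ⊗ U_R(g)) ρ = λ(g) ρ for all g ∈ G, for some λ : G → ℂ. Then ω_L is a 2-coboundary: there exists μ : G → ℂ∖{0} with ω_L(g,h) = μ(g)μ(h)/μ(gh) for all g, h ∈ G. -/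

import Mathlib

open Matrix Kronecker

/-- The rank-one operator `|ψ⟩⟨ψ| : v ↦ ⟨ψ, v⟩ ψ`, as a matrix. -/
noncomputable def outer {ι : Type*} [Fintype ι] (ψ : ι → ℂ) : Matrix ι ι ℂ :=
  Matrix.of fun i j => ψ i * (starRingEnd ℂ) (ψ j)

theorem outer_eq_vecMulVec {ι : Type*} [Fintype ι] (ψ : ι → ℂ) :
    outer ψ = vecMulVec ψ (star ψ) := rfl

theorem mul_outer_mul_conjTranspose {ι : Type*} [Fintype ι] (M : Matrix ι ι ℂ) (ψ : ι → ℂ) :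
    M * outer ψ * Mᴴ = outer (M *ᵥ ψ) := by
  rw [outer_eq_vecMulVec, outer_eq_vecMulVec, mul_vecMulVec, vecMulVec_mul, star_mulVec]

/-- An operator annihilating a positive combination of rank-one projections annihilates each
of the vectors. -/
theorem mulVec_eq_zero_of_mul_sum_outer_eq_zero {ι α : Type*} [Fintype ι] [Fintype α]
    {M : Matrix ι ι ℂ} {p : α → ℝ} (hp : ∀ i, 0 < p i) {v : α → ι → ℂ}
    (h : M * ∑ i, (p i : ℂ) • outer (v i) = 0) (i : α) : M *ᵥ v i = 0 := by
  have hsum : ∑ j, (p j : ℂ) • outer (M *ᵥ v j) = 0 := by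
    simpa [Finset.mul_sum, Finset.sum_mul, mul_outer_mul_conjTranspose] using
      congrArg (· * Mᴴ) h
  ext q
  have hentry : ∑ j, p j * Complex.normSq ((M *ᵥ v j) q) = 0 := by
    have hq := congrFun (congrFun hsum q) q
    simp only [Matrix.sum_apply, Matrix.smul_apply, outer, Matrix.of_apply, Complex.mul_conj,
      smul_eq_mul, Matrix.zero_apply] at hq
    exact_mod_cast hq
  have hi := (Finset.sum_eq_zero_iff_of_nonneg
    (fun j _ => mul_nonneg (hp j).le (Complex.normSq_nonneg _))).1 hentry i (Finset.mem_univ i)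
  simpa [(hp i).ne'] using hi

theorem kronecker_mulVec_mul {ι κ : Type*} [Fintype ι] [Fintype κ]
    (A : Matrix ι ι ℂ) (B : Matrix κ κ ℂ) (a : ι → ℂ) (b : κ → ℂ) (x : ι) (y : κ) :
    ((A ⊗ₖ B) *ᵥ fun q : ι × κ => a q.1 * b q.2) (x, y) = (A *ᵥ a) x * (B *ᵥ b) y := by
  simp only [mulVec, dotProduct, kroneckerMap_apply, Fintype.sum_prod_type, Finset.sum_mul_sum]
  exact Finset.sum_congr rfl fun _ _ => Finset.sum_congr rfl fun _ _ => by ring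

theorem mulVec_ne_zero_of_mem_unitaryGroup {ι : Type*} [Fintype ι] [DecidableEq ι]
    {U : Matrix ι ι ℂ} (hU : U ∈ Matrix.unitaryGroup ι ℂ) {v : ι → ℂ} (hv : v ≠ 0) :
    U *ᵥ v ≠ 0 := fun h => hv <| by
  rw [← one_mulVec v, ← mem_unitaryGroup_iff'.1 hU, ← mulVec_mulVec, h, mulVec_zero]

/-- If a product vector is an eigenvector of `A ⊗ B`, and `B b ≠ 0`, then its left factor is an
eigenvector of `A`. -/
theorem exists_mulVec_eq_smul_of_kronecker {ι κ : Type*} [Fintype ι] [Fintype κ]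
    {A : Matrix ι ι ℂ} {B : Matrix κ κ ℂ} {a : ι → ℂ} {b : κ → ℂ} {l : ℂ}
    (h : ((A ⊗ₖ B) *ᵥ fun q : ι × κ => a q.1 * b q.2) = l • fun q : ι × κ => a q.1 * b q.2)
    (hB : B *ᵥ b ≠ 0) : ∃ c : ℂ, A *ᵥ a = c • a := by
  obtain ⟨y, hy⟩ := Function.ne_iff.1 hB
  refine ⟨l * b y / (B *ᵥ b) y, funext fun x => ?_⟩
  have hxy := congrFun h (x, y)
  rw [kronecker_mulVec_mul] at hxy
  rw [Pi.smul_apply, smul_eq_mul, div_mul_eq_mul_div, eq_div_iff hy, hxy]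
  simp only [Pi.smul_apply, smul_eq_mul]
  ring

/-- If `U_L : G → U(H_L)` is a projective representation with 2-cocycle `ω_L`,
`U_R(g)` are arbitrary unitaries on `H_R`, and a nonzero bipartite separable state
`ρ = Σ_i p_i |a_i ⊗ b_i⟩⟨a_i ⊗ b_i|` is strongly symmetric under all `U_L(g) ⊗ U_R(g)`,
then `ω_L` is a 2-coboundary. -/
theorem cocycle_is_coboundary_of_separable_strongly_symmetric_state
    {G : Type*} [Group G] {ι κ : Type*}
    [Fintype ι] [DecidableEq ι] [Fintype κ] [DecidableEq κ]
    (UL : G → Matrix ι ι ℂ) (hUL : ∀ g, UL g ∈ Matrix.unitaryGroup ι ℂ)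
    (ωL : G → G → ℂ) (hωL : ∀ g h, ωL g h ≠ 0)
    (hrep : ∀ g h, UL g * UL h = ωL g h • UL (g * h))
    (UR : G → Matrix κ κ ℂ) (hUR : ∀ g, UR g ∈ Matrix.unitaryGroup κ ℂ)
    (n : ℕ) (p : Fin n → ℝ) (hp : ∀ i, 0 < p i)
    (a : Fin n → ι → ℂ) (b : Fin n → κ → ℂ)
    (ρ : Matrix (ι × κ) (ι × κ) ℂ)
    (hρdef : ρ = ∑ i, (p i : ℂ) • outer (fun q : ι × κ => a i q.1 * b i q.2))
    (hρne : ρ ≠ 0) (lam : G → ℂ)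
    (hsym : ∀ g, (UL g ⊗ₖ UR g) * ρ = lam g • ρ) :
    ∃ μ : G → ℂ, (∀ g, μ g ≠ 0) ∧ ∀ g h, ωL g h = μ g * μ h / μ (g * h) := by
  obtain ⟨i, hi⟩ : ∃ i, (fun q : ι × κ => a i q.1 * b i q.2) ≠ 0 := by
    by_contra! h
    refine hρne (hρdef.trans (Finset.sum_eq_zero fun i _ => ?_))
    rw [h i, outer_eq_vecMulVec, zero_vecMulVec, smul_zero]
  have ha : a i ≠ 0 := fun h => hi (by ext; simp [h])
  have hb : b i ≠ 0 := fun h => hi (by ext; simp [h])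
  have heig (g : G) : ∃ c : ℂ, UL g *ᵥ a i = c • a i := by
    refine exists_mulVec_eq_smul_of_kronecker (B := UR g) (b := b i) (l := lam g) ?_
      (mulVec_ne_zero_of_mem_unitaryGroup (hUR g) hb)
    have hann : ((UL g ⊗ₖ UR g) - lam g • 1) * ρ = 0 := by
      rw [sub_mul, hsym, smul_mul_assoc, one_mul, sub_self]
    rw [hρdef] at hann
    have hv := mulVec_eq_zero_of_mul_sum_outer_eq_zero hp hann i
    rwa [sub_mulVec, smul_mulVec, one_mulVec, sub_eq_zero] at hv
  choose μ hμ using heig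
  have hμne (g : G) : μ g ≠ 0 := fun h =>
    mulVec_ne_zero_of_mem_unitaryGroup (hUL g) ha (by rw [hμ, h, zero_smul])
  refine ⟨μ, hμne, fun g h => (eq_div_iff (hμne _)).2 (smul_left_injective ℂ ha ?_)⟩
  have hgh := congrArg (· *ᵥ a i) (hrep g h)
  simp only [← mulVec_mulVec, smul_mulVec, hμ, mulVec_smul, smul_smul] at hgh
  simpa [mul_comm (μ g)] using hgh.symm
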